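/- Let Γ be a subgroup of SL(2,ℝ) such that Γ is not commutative and every element γ ∈ Γ is hyperbolic, meaning there exist an invertible real 2×2 matrix P and a real number λ > 0 with γ = P · diag(λ, λ⁻¹) · P⁻¹. Then Γ is Zariski-dense in SL(2,ℝ): for every polynomial p with real coefficients in the four matrix-entry variables, if p vanishes when evaluated at the entries of every element of Γ, then p vanishes when evaluated at the entries of every element of SL(2,ℝ). -/

import Mathlib

open Matrix
open scoped MatrixGroups

/-- `f` agrees away from `0` with a Laurent polynomial. -/
def IsLaurent (f : ℝ → ℝ) : Prop :=
  ∃ (N : ℕ) (G : Polynomial ℝ), ∀ t, t ≠ 0 → t ^ N * f t = G.eval t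

namespace IsLaurent

lemma const (c : ℝ) : IsLaurent (fun _ => c) := ⟨0, Polynomial.C c, by simp⟩

lemma id : IsLaurent (fun t => t) := ⟨0, Polynomial.X, by simp⟩

lemma inv : IsLaurent (fun t => t⁻¹) := ⟨1, 1, fun t ht => by simp [ht]⟩

lemma add {f g : ℝ → ℝ} (hf : IsLaurent f) (hg : IsLaurent g) :
    IsLaurent (fun t => f t + g t) := by
  obtain ⟨N, F, hF⟩ := hf
  obtain ⟨M, G, hG⟩ := hg
  refine ⟨N + M, Polynomial.X ^ M * F + Polynomial.X ^ N * G, fun t ht => ?_⟩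
  simp only [Polynomial.eval_add, Polynomial.eval_mul, Polynomial.eval_pow, Polynomial.eval_X,
    ← hF t ht, ← hG t ht]
  ring

lemma mul {f g : ℝ → ℝ} (hf : IsLaurent f) (hg : IsLaurent g) :
    IsLaurent (fun t => f t * g t) := by
  obtain ⟨N, F, hF⟩ := hf
  obtain ⟨M, G, hG⟩ := hg
  refine ⟨N + M, F * G, fun t ht => ?_⟩
  simp only [Polynomial.eval_mul, ← hF t ht, ← hG t ht]
  ring

lemma eval {σ : Type*} {f : σ → ℝ → ℝ} (hf : ∀ i, IsLaurent (f i)) (p : MvPolynomial σ ℝ) :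
    IsLaurent (fun t => MvPolynomial.eval (fun i => f i t) p) := by
  induction p using MvPolynomial.induction_on with
  | C a => simpa using const a
  | add p q hp hq => simpa using hp.add hq
  | mul_X p i hp => simpa using hp.mul (hf i)

lemma eq_zero_of_infinite {f : ℝ → ℝ} (hf : IsLaurent f)
    (h : {t : ℝ | t ≠ 0 ∧ f t = 0}.Infinite) {t : ℝ} (ht : t ≠ 0) : f t = 0 := by
  obtain ⟨N, G, hG⟩ := hf
  have hG0 : G = 0 := by
    refine Polynomial.eq_zero_of_infinite_isRoot G (h.mono ?_)
    rintro s ⟨hs, hfs⟩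
    simp [Polynomial.IsRoot, ← hG s hs, hfs]
  simpa [hG0, ht] using hG t ht

end IsLaurent

/-- A set of matrices is Laurent-closed if a Laurent curve meeting it at infinitely many
nonzero parameters stays in it. -/
def LaurentClosed (C : Set (Matrix (Fin 2) (Fin 2) ℝ)) : Prop :=
  ∀ M : ℝ → Matrix (Fin 2) (Fin 2) ℝ, (∀ i j, IsLaurent (fun t => M t i j)) →
    {t : ℝ | t ≠ 0 ∧ M t ∈ C}.Infinite → ∀ t, t ≠ 0 → M t ∈ C

lemma isLaurent_of_entries {f g h k : ℝ → ℝ} (hf : IsLaurent f) (hg : IsLaurent g)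
    (hh : IsLaurent h) (hk : IsLaurent k) (i j : Fin 2) :
    IsLaurent (fun t => (!![f t, g t; h t, k t] : Matrix (Fin 2) (Fin 2) ℝ) i j) := by
  fin_cases i <;> fin_cases j <;> simpa

/-- The set of common zeros of all polynomials vanishing on `S`. -/
def zariskiClosure (S : Set (Matrix (Fin 2) (Fin 2) ℝ)) : Set (Matrix (Fin 2) (Fin 2) ℝ) :=
  {A | ∀ p : MvPolynomial (Fin 2 × Fin 2) ℝ,
    (∀ B ∈ S, MvPolynomial.eval (fun ij : Fin 2 × Fin 2 => B ij.1 ij.2) p = 0) →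
      MvPolynomial.eval (fun ij : Fin 2 × Fin 2 => A ij.1 ij.2) p = 0}

lemma subset_zariskiClosure (S : Set (Matrix (Fin 2) (Fin 2) ℝ)) : S ⊆ zariskiClosure S :=
  fun A hA _ hp => hp A hA

lemma laurentClosed_zariskiClosure (S : Set (Matrix (Fin 2) (Fin 2) ℝ)) :
    LaurentClosed (zariskiClosure S) := by
  intro M hM hinf t ht p hp
  refine (IsLaurent.eval (f := fun (ij : Fin 2 × Fin 2) t => M t ij.1 ij.2)
    (fun ij => hM ij.1 ij.2) p).eq_zero_of_infinite (hinf.mono ?_) ht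
  rintro s ⟨hs, hMs⟩
  exact ⟨hs, hMs p hp⟩

lemma eval_bind₁ {σ τ R : Type*} [CommSemiring R] (v : τ → R) (h : σ → MvPolynomial τ R)
    (p : MvPolynomial σ R) :
    MvPolynomial.eval v (MvPolynomial.bind₁ h p) =
      MvPolynomial.eval (fun i => MvPolynomial.eval v (h i)) p :=
  MvPolynomial.eval₂Hom_bind₁ (RingHom.id R) v h p

lemma exists_eval_mul_left (A : Matrix (Fin 2) (Fin 2) ℝ) (p : MvPolynomial (Fin 2 × Fin 2) ℝ) :
    ∃ q : MvPolynomial (Fin 2 × Fin 2) ℝ, ∀ B : Matrix (Fin 2) (Fin 2) ℝ,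
      MvPolynomial.eval (fun ij => B ij.1 ij.2) q =
        MvPolynomial.eval (fun ij => (A * B) ij.1 ij.2) p := by
  refine ⟨MvPolynomial.bind₁ (fun ij => ∑ k, MvPolynomial.C (A ij.1 k) *
    MvPolynomial.X (k, ij.2)) p, fun B => ?_⟩
  simp [eval_bind₁, Matrix.mul_apply]

lemma exists_eval_mul_right (A : Matrix (Fin 2) (Fin 2) ℝ) (p : MvPolynomial (Fin 2 × Fin 2) ℝ) :
    ∃ q : MvPolynomial (Fin 2 × Fin 2) ℝ, ∀ B : Matrix (Fin 2) (Fin 2) ℝ,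
      MvPolynomial.eval (fun ij => B ij.1 ij.2) q =
        MvPolynomial.eval (fun ij => (B * A) ij.1 ij.2) p := by
  refine ⟨MvPolynomial.bind₁ (fun ij => ∑ k, MvPolynomial.X (ij.1, k) *
    MvPolynomial.C (A k ij.2)) p, fun B => ?_⟩
  simp [eval_bind₁, Matrix.mul_apply]

lemma mul_mem_zariskiClosure {S : Set (Matrix (Fin 2) (Fin 2) ℝ)}
    (hS : ∀ A ∈ S, ∀ B ∈ S, A * B ∈ S) {A B : Matrix (Fin 2) (Fin 2) ℝ}
    (hA : A ∈ zariskiClosure S) (hB : B ∈ zariskiClosure S) : A * B ∈ zariskiClosure S := by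
  intro p hp
  obtain ⟨q, hq⟩ := exists_eval_mul_right B p
  rw [← hq]
  refine hA q fun G hG => ?_
  rw [hq]
  obtain ⟨r, hr⟩ := exists_eval_mul_left G p
  rw [← hr]
  refine hB r fun H hH => ?_
  rw [hr]
  exact hp _ (hS G hG H hH)

lemma LaurentClosed.conj {C : Set (Matrix (Fin 2) (Fin 2) ℝ)} (hC : LaurentClosed C)
    (P Q : Matrix (Fin 2) (Fin 2) ℝ) : LaurentClosed {A | P * A * Q ∈ C} := by
  intro M hM hinf t ht
  refine hC (fun t => P * M t * Q) (fun i j => ?_) hinf t ht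
  simp only [Matrix.mul_apply, Fin.sum_univ_two]
  have h (k m : Fin 2) := (IsLaurent.const (P k m)).mul (hM m 0)
  have h' (k m : Fin 2) := (IsLaurent.const (P k m)).mul (hM m 1)
  exact (((h i 0).add (h i 1)).mul (.const _)).add (((h' i 0).add (h' i 1)).mul (.const _))

lemma finite_biquadratic_roots {α β γ : ℝ} (h : α ≠ 0 ∨ β ≠ 0 ∨ γ ≠ 0) :
    {w : ℝ | α * w ^ 4 + β * w ^ 2 + γ = 0}.Finite := by
  by_contra hinf
  have h0 := Polynomial.eq_zero_of_infinite_isRoot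
    (Polynomial.C α * Polynomial.X ^ 4 + Polynomial.C β * Polynomial.X ^ 2 + Polynomial.C γ)
    (Set.Infinite.mono (fun w hw => by simpa [Polynomial.IsRoot] using hw) hinf)
  have h4 := congrArg (fun q => Polynomial.coeff q 4) h0
  have h2 := congrArg (fun q => Polynomial.coeff q 2) h0
  have h1 := congrArg (fun q => Polynomial.coeff q 0) h0
  simp [Polynomial.coeff_X_pow, Polynomial.coeff_C] at h4 h2 h1
  simp_all

section LaurentClosedSemigroup

variable {C : Set (Matrix (Fin 2) (Fin 2) ℝ)}

lemma diagonal_mem_of_pow_mem (hL : LaurentClosed C) {l : ℝ} (hl : 0 < l) (hl1 : l ≠ 1)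
    (hD : ∀ n : ℕ, !![l ^ n, 0; 0, (l ^ n)⁻¹] ∈ C) {t : ℝ} (ht : t ≠ 0) :
    !![t, 0; 0, t⁻¹] ∈ C := by
  refine hL (fun t => !![t, 0; 0, t⁻¹])
    (isLaurent_of_entries .id (.const 0) (.const 0) .inv) ?_ t ht
  refine (Set.infinite_range_of_injective (pow_right_injective₀ hl hl1)).mono ?_
  rintro _ ⟨n, rfl⟩
  exact ⟨pow_ne_zero n hl.ne', hD n⟩

lemma infinite_of_sq_mem {S : Set ℝ} (h : ∀ s : ℝ, s ≠ 0 → s ^ 2 ∈ S) : S.Infinite := by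
  refine (Set.Ioi_infinite (0 : ℝ)).mono fun r hr => ?_
  have h0 : Real.sqrt r ≠ 0 := (Real.sqrt_pos.2 hr).ne'
  simpa [Real.sq_sqrt (le_of_lt hr)] using h _ h0

variable (hL : LaurentClosed C) (hmul : ∀ A ∈ C, ∀ B ∈ C, A * B ∈ C)
  (hD : ∀ t : ℝ, t ≠ 0 → !![t, 0; 0, t⁻¹] ∈ C)

include hL hmul hD

lemma scale_diagonal_mem {a b c d r : ℝ} (hr : r ≠ 0) (h : !![a, b; c, d] ∈ C) :
    !![r * a, b; c, r⁻¹ * d] ∈ C := by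
  refine hL (fun r => !![r * a, b; c, r⁻¹ * d]) (isLaurent_of_entries (IsLaurent.id.mul (.const a))
    (.const b) (.const c) (IsLaurent.inv.mul (.const d))) (infinite_of_sq_mem fun s hs => ?_) r hr
  refine ⟨pow_ne_zero 2 hs, ?_⟩
  convert hmul _ (hmul _ (hD s hs) _ h) _ (hD s hs) using 1
  ext i j
  fin_cases i <;> fin_cases j <;> simp [Matrix.mul_apply, Fin.sum_univ_two] <;> field_simp

lemma scale_antidiagonal_mem {a b c d r : ℝ} (hr : r ≠ 0) (h : !![a, b; c, d] ∈ C) :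
    !![a, r * b; r⁻¹ * c, d] ∈ C := by
  refine hL (fun r => !![a, r * b; r⁻¹ * c, d]) (isLaurent_of_entries (.const a)
    (IsLaurent.id.mul (.const b)) (IsLaurent.inv.mul (.const c)) (.const d))
    (infinite_of_sq_mem fun s hs => ?_) r hr
  refine ⟨pow_ne_zero 2 hs, ?_⟩
  convert hmul _ (hmul _ (hD s hs) _ h) _ (hD s⁻¹ (inv_ne_zero hs)) using 1
  ext i j
  fin_cases i <;> fin_cases j <;> simp [Matrix.mul_apply, Fin.sum_univ_two] <;> field_simp

lemma mem_of_upper_ne_zero {a b c d : ℝ} (hy : !![a, b; c, d] ∈ C) (hdet : a * d - b * c = 1)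
    (hbc : b * c ≠ 0) (htr : a + d ≠ 0) {u v z w : ℝ} (hu : u ≠ 0) (hv : v ≠ 0)
    (h1 : u * w - v * z = 1) : !![u, v; z, w] ∈ C := by
  set δ := 1 - u * w with hδ
  have key : !![u, v; v⁻¹ * (1 - δ + -1), u⁻¹ * (1 - δ)] ∈ C := by
    refine hL (fun t => !![u, v; v⁻¹ * (t - δ + -1), u⁻¹ * (t - δ)])
      (isLaurent_of_entries (.const u) (.const v)
        ((IsLaurent.const v⁻¹).mul ((IsLaurent.id.add (.const (-δ))).add (.const (-1))))
        ((IsLaurent.const u⁻¹).mul (IsLaurent.id.add (.const (-δ))))) ?_ 1 one_ne_zero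
    intro hfin
    set F := {t : ℝ | t ≠ 0 ∧ !![u, v; v⁻¹ * (t - δ + -1), u⁻¹ * (t - δ)] ∈ C}
    have hb : b ≠ 0 := left_ne_zero_of_mul hbc
    have had : a ≠ 0 ∨ d ≠ 0 := by
      by_contra! h
      exact htr (by simp [h.1, h.2])
    have hroots : (⋃ k ∈ insert 0 F, {x : ℝ | (a ^ 2 * (b * c)) * x ^ 4 +
        (a ^ 2 * d ^ 2 + b ^ 2 * c ^ 2 + δ - k) * x ^ 2 + b * c * d ^ 2 = 0}).Finite := by
      refine (hfin.insert 0).biUnion fun k _ => finite_biquadratic_roots ?_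
      rcases had with h | h
      · exact Or.inl (mul_ne_zero (pow_ne_zero 2 h) hbc)
      · exact Or.inr (Or.inr (mul_ne_zero hbc (pow_ne_zero 2 h)))
    have hA := finite_biquadratic_roots (α := 0) (β := a ^ 2) (γ := b * c) (by simp [hbc])
    have hB := finite_biquadratic_roots (α := 0) (β := a) (γ := d) (by tauto)
    refine Set.infinite_univ ((((Set.finite_singleton (0 : ℝ)).union hA).union
      (hB.union hroots)).subset fun x _ => ?_)
    by_contra hx
    simp only [Set.mem_union, Set.mem_singleton_iff, Set.mem_ofPred_eq, Set.mem_iUnion, not_or,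
      not_exists, zero_mul, zero_add] at hx
    obtain ⟨⟨hx0, hxA⟩, hxB, hxF⟩ := hx
    set m00 := a ^ 2 * x + b * c * x⁻¹ with h00
    set m01 := a * b * x + b * d * x⁻¹ with h01
    set m10 := a * c * x + c * d * x⁻¹ with h10
    set m11 := b * c * x + d ^ 2 * x⁻¹ with h11
    have n00 : m00 ≠ 0 := by
      intro h
      apply hxA
      rw [h00] at h
      field_simp at h
      linarith
    have n01 : m01 ≠ 0 := by
      intro h
      apply hxB
      have : b * (a * x ^ 2 + d) = 0 := by
        rw [h01] at h
        field_simp at h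
        linear_combination h
      exact (mul_eq_zero.1 this).resolve_left hb
    have hM : !![m00, m01; m10, m11] ∈ C := by
      convert hmul _ (hmul _ hy _ (hD x hx0)) _ hy using 1
      ext i j
      fin_cases i <;> fin_cases j <;> simp [Matrix.mul_apply, Fin.sum_univ_two, m00, m01, m10, m11]
        <;> ring
    have hk : (m00 * m11) * x ^ 2 = (a ^ 2 * (b * c)) * x ^ 4 +
        (a ^ 2 * d ^ 2 + b ^ 2 * c ^ 2) * x ^ 2 + b * c * d ^ 2 := by
      rw [h00, h11]
      field_simp
      ring
    have hdetM : m00 * m11 - m01 * m10 = 1 := by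
      have : m00 * m11 - m01 * m10 = (a * d - b * c) ^ 2 := by
        rw [h00, h11, h01, h10]
        field_simp
        ring
      rw [this, hdet, one_pow]
    refine hxF (m00 * m11 + δ) ?_ (by linear_combination -hk)
    rw [Set.mem_insert_iff]
    refine or_iff_not_imp_left.2 fun hne => ⟨hne, ?_⟩
    convert scale_diagonal_mem hL hmul hD (div_ne_zero hu n00)
      (scale_antidiagonal_mem hL hmul hD (div_ne_zero hv n01) hM) using 1
    have e : m00 * m11 + δ - δ + -1 = m01 * m10 := by linarith
    rw [e]
    ext i j
    fin_cases i <;> fin_cases j <;> simp <;> field_simp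
  convert key using 1
  have e1 : 1 - δ + -1 = v * z := by linarith
  have e2 : 1 - δ = u * w := by linarith
  rw [e1, e2, inv_mul_cancel_left₀ hv, inv_mul_cancel_left₀ hu]

lemma mem_of_det_eq_one {a b c d : ℝ} (hy : !![a, b; c, d] ∈ C) (hdet : a * d - b * c = 1)
    (hbc : b * c ≠ 0) (htr : a + d ≠ 0) {u v z w : ℝ} (h1 : u * w - v * z = 1) :
    !![u, v; z, w] ∈ C := by
  have gen {u v z w : ℝ} (hu : u ≠ 0) (hv : v ≠ 0) (h1 : u * w - v * z = 1) :
      !![u, v; z, w] ∈ C := mem_of_upper_ne_zero hL hmul hD hy hdet hbc htr hu hv h1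
  by_cases hu : u = 0
  · subst hu
    have hv : v ≠ 0 := by
      rintro rfl
      simp at h1
    have hA : !![v, 2 * v; z + w, z + 2 * w] ∈ C :=
      gen hv (by simpa using hv) (by linear_combination h1)
    have hB : !![(2 : ℝ), -1; -1, 1] ∈ C := gen (by norm_num) (by norm_num) (by norm_num)
    convert hmul _ hA _ hB using 1
    ext i j
    fin_cases i <;> fin_cases j <;> simp [Matrix.mul_apply, Fin.sum_univ_two] <;> ring
  · by_cases hv : v = 0
    · subst hv
      have hA : !![u, u; z, z + w] ∈ C := gen hu hu (by linear_combination h1)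
      have hB : !![(1 : ℝ), -1; 0, 1] ∈ C := gen (by norm_num) (by norm_num) (by norm_num)
      convert hmul _ hA _ hB using 1
      ext i j
      fin_cases i <;> fin_cases j <;> simp [Matrix.mul_apply, Fin.sum_univ_two]
    · exact gen hu hv h1

end LaurentClosedSemigroup

lemma trace_conj (P : GL (Fin 2) ℝ) (A : Matrix (Fin 2) (Fin 2) ℝ) :
    (P.val * A * (P⁻¹).val).trace = A.trace := by
  rw [Matrix.trace_mul_comm, ← mul_assoc, ← Units.val_mul, inv_mul_cancel, Units.val_one, one_mul]

/-- Fricke's formula for the trace of a commutator. -/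
lemma trace_commutator (x y : Matrix.SpecialLinearGroup (Fin 2) ℝ) :
    (x * y * x⁻¹ * y⁻¹).val.trace =
      x.val.trace ^ 2 + y.val.trace ^ 2 + (x.val * y.val).trace ^ 2
        - x.val.trace * y.val.trace * (x.val * y.val).trace - 2 := by
  have hx := x.det_coe
  have hy := y.det_coe
  rw [Matrix.det_fin_two] at hx hy
  simp only [Matrix.SpecialLinearGroup.coe_mul, Matrix.SpecialLinearGroup.coe_inv,
    Matrix.adjugate_fin_two, Matrix.trace_fin_two, Matrix.mul_apply, Fin.sum_univ_two,
    Matrix.of_apply, Matrix.cons_val_zero, Matrix.cons_val_one, Matrix.cons_val']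
  generalize x.val 0 0 = a at *
  generalize x.val 0 1 = b at *
  generalize x.val 1 0 = c at *
  generalize x.val 1 1 = d at *
  generalize y.val 0 0 = e at *
  generalize y.val 0 1 = f at *
  generalize y.val 1 0 = g at *
  generalize y.val 1 1 = h at *
  linear_combination (a + d) ^ 2 * hy + (e + h) ^ 2 * hx - 2 * (e * h - f * g) * hx - 2 * hy

/-- Lemma 3.9: any non-abelian subgroup of `SL(2,ℝ)` all of whose elements are hyperbolic
(conjugate in `GL(2,ℝ)` to `diag(λ, λ⁻¹)` with `λ > 0`) is Zariski-dense in `SL(2,ℝ)`: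
every real polynomial in the matrix entries vanishing on the subgroup vanishes on all of
`SL(2,ℝ)`. -/
theorem nonabelian_hyperbolic_subgroup_zariski_dense
    (Γ : Subgroup (Matrix.SpecialLinearGroup (Fin 2) ℝ))
    (hnc : ¬ (∀ x ∈ Γ, ∀ y ∈ Γ, x * y = y * x))
    (hhyp : ∀ γ ∈ Γ, ∃ (P : GL (Fin 2) ℝ) (l : ℝ), 0 < l ∧
      ((γ : Matrix.SpecialLinearGroup (Fin 2) ℝ) : Matrix (Fin 2) (Fin 2) ℝ) =
        (P : Matrix (Fin 2) (Fin 2) ℝ) * Matrix.diagonal ![l, l⁻¹] *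
          ((P⁻¹ : GL (Fin 2) ℝ) : Matrix (Fin 2) (Fin 2) ℝ)) :
    ∀ p : MvPolynomial (Fin 2 × Fin 2) ℝ,
      (∀ γ ∈ Γ, MvPolynomial.eval
          (fun ij : Fin 2 × Fin 2 =>
            ((γ : Matrix.SpecialLinearGroup (Fin 2) ℝ) : Matrix (Fin 2) (Fin 2) ℝ) ij.1 ij.2)
          p = 0) →
      ∀ A : Matrix.SpecialLinearGroup (Fin 2) ℝ,
        MvPolynomial.eval
          (fun ij : Fin 2 × Fin 2 => (A : Matrix (Fin 2) (Fin 2) ℝ) ij.1 ij.2) p = 0 := by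
  have htr2 : ∀ γ ∈ Γ, 0 < γ.val.trace ∧ (γ.val.trace = 2 → γ = 1) := by
    intro γ hγ
    obtain ⟨P, l, hl, h⟩ := hhyp γ hγ
    have ht : γ.val.trace = l + l⁻¹ := by
      rw [h, trace_conj, Matrix.trace_fin_two]
      simp
    refine ⟨by rw [ht]; positivity, fun h2 => ?_⟩
    have hl1 : l = 1 := by
      rw [ht] at h2
      field_simp at h2
      nlinarith [sq_nonneg (l - 1)]
    subst hl1
    have hone : Matrix.diagonal ![(1 : ℝ), 1⁻¹] = 1 := by
      ext i j
      fin_cases i <;> fin_cases j <;> simp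
    apply Subtype.ext
    rw [h, hone, mul_one, ← Units.val_mul, mul_inv_cancel]
    rfl
  push Not at hnc
  obtain ⟨x, hx, y, hy, hxy⟩ := hnc
  obtain ⟨P, l, hl, hP⟩ := hhyp x hx
  have hPP : (P⁻¹).val * P.val = 1 := by rw [← Units.val_mul, inv_mul_cancel, Units.val_one]
  have hPP' : P.val * (P⁻¹).val = 1 := by rw [← Units.val_mul, mul_inv_cancel, Units.val_one]
  have conj_conj (A : Matrix (Fin 2) (Fin 2) ℝ) :
      P.val * ((P⁻¹).val * A * P.val) * (P⁻¹).val = A := by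
    calc _ = (P.val * (P⁻¹).val) * A * (P.val * (P⁻¹).val) := by simp only [mul_assoc]
      _ = A := by rw [hPP', one_mul, mul_one]
  have conj_mul (A B : Matrix (Fin 2) (Fin 2) ℝ) :
      P.val * (A * B) * (P⁻¹).val = (P.val * A * (P⁻¹).val) * (P.val * B * (P⁻¹).val) := by
    calc _ = P.val * A * 1 * B * (P⁻¹).val := by simp only [mul_assoc, one_mul]
      _ = _ := by rw [← hPP]; simp only [mul_assoc]
  obtain ⟨a, b, c, d, hY⟩ : ∃ a b c d : ℝ, (P⁻¹).val * y.val * P.val = !![a, b; c, d] :=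
    ⟨_, _, _, _, Matrix.eta_fin_two _⟩
  have hyY : y.val = P.val * !![a, b; c, d] * (P⁻¹).val := by rw [← hY, conj_conj]
  have hdiag : Matrix.diagonal ![l, l⁻¹] = !![l, 0; 0, l⁻¹] := by
    ext i j
    fin_cases i <;> fin_cases j <;> simp
  rw [hdiag] at hP
  have hdet : a * d - b * c = 1 := by
    have h := y.det_coe
    rw [hyY, Matrix.det_mul_right_comm, hPP', one_mul, Matrix.det_fin_two_of] at h
    exact h
  have htrx : x.val.trace = l + l⁻¹ := by rw [hP, trace_conj, Matrix.trace_fin_two_of]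
  have htry : y.val.trace = a + d := by rw [hyY, trace_conj, Matrix.trace_fin_two_of]
  have htrxy : (x.val * y.val).trace = l * a + l⁻¹ * d := by
    rw [hP, hyY, ← conj_mul, trace_conj, Matrix.trace_fin_two]
    simp [Matrix.mul_apply, Fin.sum_univ_two]
  have hbc : b * c ≠ 0 := by
    intro h0
    refine hxy ?_
    have hc := (htr2 (x * y * x⁻¹ * y⁻¹)
      (Γ.mul_mem (Γ.mul_mem (Γ.mul_mem hx hy) (Γ.inv_mem hx)) (Γ.inv_mem hy))).2 ?_
    · exact mul_inv_eq_iff_eq_mul.1 (mul_inv_eq_one.1 hc)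
    · rw [trace_commutator, htrx, htry, htrxy]
      have had : a * d = 1 := by linarith
      have hll : l * l⁻¹ = 1 := mul_inv_cancel₀ hl.ne'
      generalize l⁻¹ = m at *
      linear_combination -(l + m) ^ 2 * had - (a + d) ^ 2 * hll + 4 * (a * d) * hll + 4 * had
  have hl1 : l ≠ 1 := by
    rintro rfl
    refine hxy ?_
    rw [(htr2 x hx).2 (by rw [htrx]; norm_num), one_mul, mul_one]
  have htr : a + d ≠ 0 := by
    rw [← htry]
    exact (htr2 y hy).1.ne'
  intro p hp A
  let S : Set (Matrix (Fin 2) (Fin 2) ℝ) := {M | ∃ g ∈ Γ, g.val = M}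
  have hS : ∀ A ∈ S, ∀ B ∈ S, A * B ∈ S := by
    rintro _ ⟨g, hg, rfl⟩ _ ⟨h, hh, rfl⟩
    exact ⟨g * h, Γ.mul_mem hg hh, Matrix.SpecialLinearGroup.coe_mul g h⟩
  let C : Set (Matrix (Fin 2) (Fin 2) ℝ) := {M | P.val * M * (P⁻¹).val ∈ zariskiClosure S}
  have hC : LaurentClosed C := (laurentClosed_zariskiClosure S).conj _ _
  have hmul : ∀ A ∈ C, ∀ B ∈ C, A * B ∈ C := by
    intro A hA B hB
    change _ ∈ zariskiClosure S
    rw [conj_mul]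
    exact mul_mem_zariskiClosure hS hA hB
  have hpow (n : ℕ) : P.val * !![l ^ n, 0; 0, (l ^ n)⁻¹] * (P⁻¹).val = (x ^ n).val := by
    induction n with
    | zero => simp [← Matrix.one_fin_two]
    | succ n ih =>
      rw [pow_succ x, Matrix.SpecialLinearGroup.coe_mul, ← ih, hP, ← conj_mul]
      congr 2
      ext i j
      fin_cases i <;> fin_cases j <;>
        simp [Matrix.mul_apply, Fin.sum_univ_two, pow_succ, mul_comm]
  have hD (t : ℝ) (ht : t ≠ 0) : !![t, 0; 0, t⁻¹] ∈ C := by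
    refine diagonal_mem_of_pow_mem hC hl hl1 (fun n => ?_) ht
    change _ ∈ zariskiClosure S
    rw [hpow]
    exact subset_zariskiClosure S ⟨_, Γ.pow_mem hx n, rfl⟩
  have hyC : !![a, b; c, d] ∈ C := by
    change _ ∈ zariskiClosure S
    rw [← hyY]
    exact subset_zariskiClosure S ⟨y, hy, rfl⟩
  have hAC : (P⁻¹).val * A.val * P.val ∈ C := by
    rw [Matrix.eta_fin_two ((P⁻¹).val * A.val * P.val)]
    refine mem_of_det_eq_one hC hmul hD hyC hdet hbc htr ?_
    rw [← Matrix.det_fin_two, Matrix.det_mul_right_comm, hPP, one_mul, A.det_coe]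
  have hA : A.val ∈ zariskiClosure S := by
    rw [← conj_conj A.val]
    exact hAC
  refine hA p ?_
  rintro _ ⟨γ, hγ, rfl⟩
  exact hp γ hγ
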